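/- arXiv:1206.0673 — 7 statements merged into one kernel-verified Lean document; each statement's English description precedes it below -/
import Mathlib

section
/- Let M ≥ 2 be an integer and θ = 2π/M. Let p : ℕ → ℝ be a summable sequence of nonnegative reals with ∑_{n=0}^∞ p(n) = 1 whose mod-M reduction 𝔭 is uniform, i.e., 𝔭(ν) = 1/M for every ν ∈ {0, …, M−1}. Then the Gram matrix is the identity: for all m, m' ∈ {0, …, M−1}, ∑_{n=0}^∞ p(n)·exp(−i·θ·(m−m')·n) equals 1 if m = m' and 0 otherwise. (Theorem 2(b): a probe with uniform mod-M photon-number distribution yields mutually orthogonal output states and hence zero-error discrimination of the M symmetric phase shifts.) -/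
/-- The power series of a summable real sequence, evaluated at an `M`-th root of unity, depends only
on the mod-`M` reduction of the sequence. -/
theorem tsum_ofReal_mul_pow_eq_sum_of_pow_eq_one {M : ℕ} [NeZero M] {p : ℕ → ℝ} (hp : Summable p)
    {z : ℂ} (hz : z ^ M = 1) :
    ∑' n : ℕ, (p n : ℂ) * z ^ n =
      ∑ ν : Fin M, ((∑' k : ℕ, p ((ν : ℕ) + k * M) : ℝ) : ℂ) * z ^ (ν : ℕ) := by
  have hnorm : ‖z‖ = 1 := Complex.norm_eq_one_of_pow_eq_one hz (NeZero.ne M)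
  have hs : Summable fun n : ℕ => (p n : ℂ) * z ^ n := by
    apply Summable.of_norm
    simpa [hnorm] using hp.abs
  rw [Nat.sumByResidueClasses hs M]
  obtain ⟨N, rfl⟩ := Nat.exists_eq_succ_of_ne_zero (NeZero.ne M)
  refine Finset.sum_congr rfl fun ν _ => ?_
  rw [Complex.ofReal_tsum, ← tsum_mul_right]
  refine tsum_congr fun k => ?_
  rw [pow_add, pow_mul, hz, one_pow, mul_one, mul_comm (N.succ) k]
  rfl

theorem stmt_3 (M : ℕ) (hM : 2 ≤ M) (θ : ℝ) (hθ : θ = 2 * Real.pi / M)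
    (p : ℕ → ℝ) (hp : ∀ n, 0 ≤ p n) (hsum : Summable p)
    (hp1 : ∑' n : ℕ, p n = 1)
    (hunif : ∀ ν : Fin M, (∑' k : ℕ, p ((ν : ℕ) + k * M)) = 1 / M) :
    ∀ m m' : Fin M,
      (∑' n : ℕ, (p n : ℂ) *
          Complex.exp (-Complex.I * (θ : ℂ) * (((m : ℤ) - (m' : ℤ) : ℤ) : ℂ) * (n : ℂ)))
        = if m = m' then 1 else 0 := by
  intro m m'
  have hM0 : M ≠ 0 := by lia
  have hMC : (M : ℂ) ≠ 0 := Nat.cast_ne_zero.mpr hM0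
  have : NeZero M := ⟨hM0⟩
  have hζ := Complex.isPrimitiveRoot_exp M hM0
  set d : ℤ := (m' : ℤ) - (m : ℤ) with hd
  set z : ℂ := Complex.exp (2 * Real.pi * Complex.I / M) ^ d with hz
  have hzM : z ^ M = 1 := by
    rw [hz, ← zpow_natCast, zpow_comm, zpow_natCast, hζ.pow_eq_one, one_zpow]
  have hterm : ∀ n : ℕ,
      Complex.exp (-Complex.I * (θ : ℂ) * (((m : ℤ) - (m' : ℤ) : ℤ) : ℂ) * (n : ℂ)) = z ^ n := by
    intro n
    rw [hz, ← Complex.exp_int_mul, ← Complex.exp_nat_mul, hθ, hd]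
    congr 1
    push_cast
    ring
  simp_rw [hterm]
  rw [tsum_ofReal_mul_pow_eq_sum_of_pow_eq_one hsum hzM]
  simp_rw [hunif]
  rw [← Finset.mul_sum, Fin.sum_univ_eq_sum_range (fun i => z ^ i) M]
  split_ifs with h
  · have hz1 : z = 1 := by simp [hz, hd, h]
    simp [hz1, hMC]
  · have hz1 : z ≠ 1 := by
      intro h1
      have hdvd := (hζ.zpow_eq_one_iff_dvd d).mp h1
      have hd0 : d = 0 := Int.eq_zero_of_abs_lt_dvd hdvd (by rw [abs_lt]; omega)
      exact h (Fin.ext (by omega))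
    rw [geom_sum_eq hz1, hzM]
    simp
end

section
/- Let M ≥ 2 be an integer, N > 0 a real number, and suppose A > 0 and B > 0 are real constants satisfying ∑_{ν=0}^{M−1} 1/(A+νB)² = 1 and ∑_{ν=0}^{M−1} ν/(A+νB)² = N. Then for every probability vector q : Fin M → ℝ (q(ν) ≥ 0, ∑_ν q(ν) = 1) with mean ∑_{ν=0}^{M−1} ν·q(ν) = N, one has ∑_{ν=0}^{M−1} √(q(ν)) ≤ ∑_{ν=0}^{M−1} 1/(A+νB). (Theorem 3(a): under the exact energy constraint, the probe distribution 𝔭(ν) = 1/(A+νB)² maximizes ∑_ν √𝔭(ν) and hence minimizes the discrimination error probability 1 − (1/M)(∑_ν √𝔭(ν))².) -/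
theorem stmt_6 (M : ℕ) (hM : 2 ≤ M) (N : ℝ) (hN : 0 < N)
    (A B : ℝ) (hA : 0 < A) (hB : 0 < B)
    (hnorm : ∑ ν : Fin M, 1 / (A + (ν : ℕ) * B) ^ 2 = 1)
    (hmean : ∑ ν : Fin M, ((ν : ℕ) : ℝ) / (A + (ν : ℕ) * B) ^ 2 = N)
    (q : Fin M → ℝ) (hq : ∀ ν, 0 ≤ q ν) (hq1 : ∑ ν : Fin M, q ν = 1)
    (hqN : ∑ ν : Fin M, ((ν : ℕ) : ℝ) * q ν = N) :
    ∑ ν : Fin M, Real.sqrt (q ν) ≤ ∑ ν : Fin M, 1 / (A + (ν : ℕ) * B) := by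
  have hw : ∀ ν : Fin M, 0 < A + ((ν : ℕ) : ℝ) * B := fun ν => by positivity
  have sqrt_le : ∀ ν : Fin M, Real.sqrt (q ν) ≤
      (1 / (A + ((ν : ℕ) : ℝ) * B) + (A + ((ν : ℕ) : ℝ) * B) * q ν) / 2 := by
    intro ν
    have h := hw ν
    set w := A + ((ν : ℕ) : ℝ) * B
    have key : 1 / w + w * q ν - 2 * Real.sqrt (q ν) = (w * Real.sqrt (q ν) - 1) ^ 2 / w := by
      nth_rewrite 1 [← Real.sq_sqrt (hq ν)]
      field_simp
      ring
    have hnonneg : 0 ≤ (w * Real.sqrt (q ν) - 1) ^ 2 / w := by positivity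
    linarith
  have sum_inv : ∑ ν : Fin M, 1 / (A + ((ν : ℕ) : ℝ) * B) = A + B * N := by
    calc ∑ ν : Fin M, 1 / (A + ((ν : ℕ) : ℝ) * B)
        = A * ∑ ν : Fin M, 1 / (A + ((ν : ℕ) : ℝ) * B) ^ 2 +
            B * ∑ ν : Fin M, ((ν : ℕ) : ℝ) / (A + ((ν : ℕ) : ℝ) * B) ^ 2 := by
          rw [Finset.mul_sum, Finset.mul_sum, ← Finset.sum_add_distrib]
          refine Finset.sum_congr rfl fun ν _ => ?_
          have h := (hw ν).ne'
          field_simp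
      _ = A + B * N := by rw [hnorm, hmean, mul_one]
  have sum_mul : ∑ ν : Fin M, (A + ((ν : ℕ) : ℝ) * B) * q ν = A + B * N := by
    calc ∑ ν : Fin M, (A + ((ν : ℕ) : ℝ) * B) * q ν
        = A * ∑ ν : Fin M, q ν + B * ∑ ν : Fin M, ((ν : ℕ) : ℝ) * q ν := by
          rw [Finset.mul_sum, Finset.mul_sum, ← Finset.sum_add_distrib]
          exact Finset.sum_congr rfl fun ν _ => by ring
      _ = A + B * N := by rw [hq1, hqN, mul_one]
  calc ∑ ν : Fin M, Real.sqrt (q ν)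
      ≤ ∑ ν : Fin M, (1 / (A + ((ν : ℕ) : ℝ) * B) + (A + ((ν : ℕ) : ℝ) * B) * q ν) / 2 :=
        Finset.sum_le_sum fun ν _ => sqrt_le ν
    _ = ∑ ν : Fin M, 1 / (A + ((ν : ℕ) : ℝ) * B) := by
        rw [← Finset.sum_div, Finset.sum_add_distrib, sum_mul, sum_inv]
        ring
end

section
/- Let M ≥ 2 be an integer, N > 0 a real number, and suppose A > 0 and B > 0 are real constants satisfying ∑_{ν=0}^{M−1} 1/(A+νB)² = 1 and ∑_{ν=0}^{M−1} ν/(A+νB)² = N. Then for every probability vector q : Fin M → ℝ (q(ν) ≥ 0, ∑_ν q(ν) = 1) whose mean satisfies the inequality constraint ∑_{ν=0}^{M−1} ν·q(ν) ≤ N, one has ∑_{ν=0}^{M−1} √(q(ν)) ≤ ∑_{ν=0}^{M−1} 1/(A+νB). (Theorem 3(a) combined with Lemma 1: the distribution 𝔭(ν) = 1/(A+νB)² is optimal among all probes obeying the average-energy inequality constraint.) -/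
theorem Real.sqrt_le_half_mul_add_inv {x c : ℝ} (hx : 0 ≤ x) (hc : 0 < c) :
    √x ≤ (c * x + 1 / c) / 2 := by
  have h : 0 ≤ c * (√x - 1 / c) ^ 2 := by positivity
  have e : c * (√x - 1 / c) ^ 2 = c * √x ^ 2 - 2 * √x + 1 / c := by
    field_simp
    ring
  rw [e, Real.sq_sqrt hx] at h
  linarith

theorem stmt_7 (M : ℕ) (hM : 2 ≤ M) (N : ℝ) (hN : 0 < N)
    (A B : ℝ) (hA : 0 < A) (hB : 0 < B)
    (hnorm : ∑ ν : Fin M, 1 / (A + (ν : ℕ) * B) ^ 2 = 1)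
    (hmean : ∑ ν : Fin M, ((ν : ℕ) : ℝ) / (A + (ν : ℕ) * B) ^ 2 = N)
    (q : Fin M → ℝ) (hq : ∀ ν, 0 ≤ q ν) (hq1 : ∑ ν : Fin M, q ν = 1)
    (hqN : ∑ ν : Fin M, ((ν : ℕ) : ℝ) * q ν ≤ N) :
    ∑ ν : Fin M, Real.sqrt (q ν) ≤ ∑ ν : Fin M, 1 / (A + (ν : ℕ) * B) := by
  have hc (ν : Fin M) : 0 < A + (ν : ℕ) * B := by positivity
  have hS : ∑ ν : Fin M, 1 / (A + (ν : ℕ) * B) = A + B * N := by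
    calc ∑ ν : Fin M, 1 / (A + (ν : ℕ) * B)
        = ∑ ν : Fin M, (A * (1 / (A + (ν : ℕ) * B) ^ 2)
            + B * (((ν : ℕ) : ℝ) / (A + (ν : ℕ) * B) ^ 2)) := by
          refine Finset.sum_congr rfl fun ν _ => ?_
          have := (hc ν).ne'
          field_simp
      _ = A + B * N := by
          rw [Finset.sum_add_distrib, ← Finset.mul_sum, ← Finset.mul_sum, hnorm, hmean, mul_one]
  have hQ : ∑ ν : Fin M, (A + (ν : ℕ) * B) * q ν
      = A + B * ∑ ν : Fin M, ((ν : ℕ) : ℝ) * q ν := by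
    calc ∑ ν : Fin M, (A + (ν : ℕ) * B) * q ν
        = ∑ ν : Fin M, (A * q ν + B * (((ν : ℕ) : ℝ) * q ν)) :=
          Finset.sum_congr rfl fun ν _ => by ring
      _ = A + B * ∑ ν : Fin M, ((ν : ℕ) : ℝ) * q ν := by
          rw [Finset.sum_add_distrib, ← Finset.mul_sum, ← Finset.mul_sum, hq1, mul_one]
  have hle := Finset.sum_le_sum fun (ν : Fin M) (_ : ν ∈ Finset.univ) =>
    Real.sqrt_le_half_mul_add_inv (hq ν) (hc ν)
  rw [← Finset.sum_div, Finset.sum_add_distrib, hQ, hS] at hle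
  have hBN := mul_le_mul_of_nonneg_left hqN hB.le
  linarith
end

section
/- Let M ≥ 2 be an integer and let N be a real number with 0 ≤ N ≤ (M−1)/2. For every probability vector q : Fin M → ℝ (q(ν) ≥ 0, ∑_ν q(ν) = 1) whose mean satisfies ∑_{ν=0}^{M−1} ν·q(ν) ≤ N, there exists a probability vector q' : Fin M → ℝ with mean exactly N, ∑_{ν=0}^{M−1} ν·q'(ν) = N, such that ∑_{ν=0}^{M−1} √(q'(ν)) ≥ ∑_{ν=0}^{M−1} √(q(ν)). (Lemma 1: the optimum under the inequality energy constraint is attained with the energy constraint tight.) -/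
theorem sum_sqrt_le_card_mul_sqrt_inv {ι : Type*} [Fintype ι] [Nonempty ι] (q : ι → ℝ)
    (hq : ∀ i, 0 ≤ q i) (hq1 : ∑ i, q i = 1) :
    ∑ i, Real.sqrt (q i) ≤ Fintype.card ι * Real.sqrt ((Fintype.card ι : ℝ)⁻¹) := by
  have hc : (0 : ℝ) < Fintype.card ι := by exact_mod_cast Fintype.card_pos
  set s := Real.sqrt ((Fintype.card ι : ℝ)⁻¹) with hs
  have hs0 : 0 < s := Real.sqrt_pos.2 (inv_pos.2 hc)
  have hs2 : Fintype.card ι * s ^ 2 = 1 := by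
    rw [hs, Real.sq_sqrt (inv_pos.2 hc).le, mul_inv_cancel₀ hc.ne']
  have h : ∑ i, 2 * s * Real.sqrt (q i) ≤ ∑ i, (q i + s ^ 2) := by
    refine Finset.sum_le_sum fun i _ => ?_
    nlinarith [sq_nonneg (s - Real.sqrt (q i)), Real.sq_sqrt (hq i)]
  rw [← Finset.mul_sum, Finset.sum_add_distrib, hq1, Finset.sum_const, Finset.card_univ,
    nsmul_eq_mul, hs2] at h
  refine le_of_mul_le_mul_left ?_ hs0
  linarith

theorem sum_sqrt_le_sum_sqrt_mix_uniform {ι : Type*} [Fintype ι] [Nonempty ι] (q : ι → ℝ)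
    (hq : ∀ i, 0 ≤ q i) (hq1 : ∑ i, q i = 1) {t : ℝ} (ht0 : 0 ≤ t) (ht1 : t ≤ 1) :
    ∑ i, Real.sqrt (q i) ≤
      ∑ i, Real.sqrt ((1 - t) * q i + t * (Fintype.card ι : ℝ)⁻¹) := by
  have hS := sum_sqrt_le_card_mul_sqrt_inv q hq hq1
  have h : ∑ i, ((1 - t) * Real.sqrt (q i) + t * Real.sqrt ((Fintype.card ι : ℝ)⁻¹)) ≤
      ∑ i, Real.sqrt ((1 - t) * q i + t * (Fintype.card ι : ℝ)⁻¹) := by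
    refine Finset.sum_le_sum fun i _ => ?_
    simpa only [smul_eq_mul] using Real.strictConcaveOn_sqrt.concaveOn.2 (hq i)
      (show (0 : ℝ) ≤ (Fintype.card ι : ℝ)⁻¹ by positivity)
      (sub_nonneg.2 ht1) ht0 (sub_add_cancel 1 t)
  rw [Finset.sum_add_distrib, ← Finset.mul_sum, Finset.sum_const, Finset.card_univ,
    nsmul_eq_mul] at h
  nlinarith [mul_le_mul_of_nonneg_left hS ht0]

theorem sum_fin_val_cast (M : ℕ) :
    ∑ ν : Fin M, ((ν : ℕ) : ℝ) = M * (((M : ℝ) - 1) / 2) := by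
  rw [Fin.sum_univ_eq_sum_range (fun n => (n : ℝ)) M]
  induction M with
  | zero => simp
  | succ k ih => rw [Finset.sum_range_succ, ih]; push_cast; ring

theorem stmt_8 (M : ℕ) (hM : 2 ≤ M) (N : ℝ) (hN0 : 0 ≤ N) (hN : N ≤ ((M : ℝ) - 1) / 2)
    (q : Fin M → ℝ) (hq : ∀ ν, 0 ≤ q ν) (hq1 : ∑ ν : Fin M, q ν = 1)
    (hqN : ∑ ν : Fin M, ((ν : ℕ) : ℝ) * q ν ≤ N) :
    ∃ q' : Fin M → ℝ, (∀ ν, 0 ≤ q' ν) ∧ (∑ ν : Fin M, q' ν = 1) ∧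
      (∑ ν : Fin M, ((ν : ℕ) : ℝ) * q' ν = N) ∧
      (∑ ν : Fin M, Real.sqrt (q ν) ≤ ∑ ν : Fin M, Real.sqrt (q' ν)) := by
  have hM0 : (M : ℝ) ≠ 0 := by
    have : M ≠ 0 := by omega
    exact_mod_cast this
  have : Nonempty (Fin M) := ⟨⟨0, by omega⟩⟩
  rcases hqN.eq_or_lt with hm | hm
  · exact ⟨q, hq, hq1, hm, le_rfl⟩
  set m := ∑ ν : Fin M, ((ν : ℕ) : ℝ) * q ν with hmdef
  have hd : 0 < ((M : ℝ) - 1) / 2 - m := by linarith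
  obtain ⟨t, ht⟩ : ∃ t, t = (N - m) / (((M : ℝ) - 1) / 2 - m) := ⟨_, rfl⟩
  have ht0 : 0 ≤ t := ht ▸ div_nonneg (by linarith) hd.le
  have ht1 : t ≤ 1 := ht ▸ (div_le_one hd).2 (by linarith)
  have htm : t * (((M : ℝ) - 1) / 2 - m) = N - m := by rw [ht, div_mul_cancel₀ _ hd.ne']
  refine ⟨fun ν => (1 - t) * q ν + t * (M : ℝ)⁻¹, fun ν => ?_, ?_, ?_, ?_⟩
  · have := mul_nonneg (sub_nonneg.2 ht1) (hq ν)
    positivity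
  · rw [Finset.sum_add_distrib, ← Finset.mul_sum, hq1, Finset.sum_const, Finset.card_univ,
      Fintype.card_fin, nsmul_eq_mul]
    field_simp
    ring
  · have h : ∀ ν : Fin M, ((ν : ℕ) : ℝ) * ((1 - t) * q ν + t * (M : ℝ)⁻¹) =
        (1 - t) * (((ν : ℕ) : ℝ) * q ν) + t * (M : ℝ)⁻¹ * ((ν : ℕ) : ℝ) := fun ν => by ring
    simp only [h]
    rw [Finset.sum_add_distrib, ← Finset.mul_sum, ← Finset.mul_sum, ← hmdef, sum_fin_val_cast,
      mul_assoc, inv_mul_cancel_left₀ hM0]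
    linarith
  · simpa only [Fintype.card_fin] using sum_sqrt_le_sum_sqrt_mix_uniform q hq hq1 ht0 ht1
end

section
/- Let M ≥ 2 be an integer and let p : ℕ → ℝ be a summable sequence of nonnegative reals with ∑_{n=0}^∞ p(n) = 1 such that n ↦ n·p(n) is summable, and suppose the mod-M reduction of p is uniform: ∑_{k=0}^∞ p(ν + kM) = 1/M for every ν ∈ {0,…,M−1}. Then the mean satisfies ∑_{n=0}^∞ n·p(n) ≥ (M−1)/2. (Theorem 3(b): any probe achieving zero-error discrimination of the M symmetric phase shifts must have signal energy at least (M−1)/2.) -/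
theorem Fin.sum_val_cast_eq (n : ℕ) :
    ∑ i : Fin n, ((i : ℕ) : ℝ) = n * (n - 1) / 2 := by
  induction n with
  | zero => simp
  | succ n ih =>
    rw [Fin.sum_univ_castSucc]
    simp only [Fin.val_castSucc, Fin.val_last, ih]
    push_cast
    ring

theorem stmt_10 (M : ℕ) (hM : 2 ≤ M)
    (p : ℕ → ℝ) (hp : ∀ n, 0 ≤ p n) (hsum : Summable p)
    (hp1 : ∑' n : ℕ, p n = 1)
    (hsum' : Summable (fun n : ℕ => (n : ℝ) * p n))
    (hunif : ∀ ν : Fin M, (∑' k : ℕ, p ((ν : ℕ) + k * M)) = 1 / M) :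
    ((M : ℝ) - 1) / 2 ≤ ∑' n : ℕ, (n : ℝ) * p n := by
  have hM0 : (M : ℝ) ≠ 0 := by positivity
  have : NeZero M := ⟨by omega⟩
  have inj (ν : Fin M) : Function.Injective (fun k : ℕ => (ν : ℕ) + k * M) := fun a b h =>
    Nat.eq_of_mul_eq_mul_right (by omega : 0 < M) (Nat.add_left_cancel h)
  have decomp : ∑' n : ℕ, (n : ℝ) * p n =
      ∑ ν : Fin M, ∑' k : ℕ, (((ν : ℕ) + k * M : ℕ) : ℝ) * p ((ν : ℕ) + k * M) := by
    rw [Nat.sumByResidueClasses hsum' M]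
    refine Fintype.sum_equiv (ZMod.finEquiv M).symm.toEquiv _ _ fun j => ?_
    obtain _ | m := M
    · omega
    · exact tsum_congr fun k => by rw [mul_comm (m + 1) k]; rfl
  calc ((M : ℝ) - 1) / 2 = ∑ ν : Fin M, ((ν : ℕ) : ℝ) * (1 / M) := by
        rw [← Finset.sum_mul, Fin.sum_val_cast_eq]
        field_simp
    _ ≤ ∑ ν : Fin M, ∑' k : ℕ, (((ν : ℕ) + k * M : ℕ) : ℝ) * p ((ν : ℕ) + k * M) := by
        refine Finset.sum_le_sum fun ν _ => ?_
        rw [← hunif ν, ← tsum_mul_left]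
        refine Summable.tsum_le_tsum (fun k => ?_)
          ((hsum.comp_injective (inj ν)).mul_left _) (hsum'.comp_injective (inj ν))
        exact mul_le_mul_of_nonneg_right (Nat.cast_le.mpr (Nat.le_add_right _ _)) (hp _)
    _ = _ := decomp.symm
end

section
/- Let N be a real number with 0 < N ≤ 1/2. Then for all reals q₀, q₁ ≥ 0 with q₀ + q₁ = 1 and q₁ ≤ N, one has 1 − (1/2)·(√q₀ + √q₁)² ≥ 1/2 − √(N·(1−N)), and equality holds for q₀ = 1−N, q₁ = N. (Corollary 1: for M = 2 the optimal probe state is √(1−N)|0⟩ + √N|1⟩, achieving minimum error probability 1/2 − √(N(1−N)).) -/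
theorem one_sub_half_sqrt_add_sqrt_sq {a b : ℝ} (ha : 0 ≤ a) (hb : 0 ≤ b) (hab : a + b = 1) :
    1 - (1 / 2) * (Real.sqrt a + Real.sqrt b) ^ 2 = 1 / 2 - Real.sqrt (b * a) := by
  rw [Real.sqrt_mul hb, add_sq, Real.sq_sqrt ha, Real.sq_sqrt hb]
  linear_combination (-1 / 2) * hab

theorem stmt_11 (N : ℝ) (hN0 : 0 < N) (hN : N ≤ 1 / 2) :
    (∀ q₀ q₁ : ℝ, 0 ≤ q₀ → 0 ≤ q₁ → q₀ + q₁ = 1 → q₁ ≤ N →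
      1 / 2 - Real.sqrt (N * (1 - N)) ≤
        1 - (1 / 2) * (Real.sqrt q₀ + Real.sqrt q₁) ^ 2) ∧
    1 - (1 / 2) * (Real.sqrt (1 - N) + Real.sqrt N) ^ 2
      = 1 / 2 - Real.sqrt (N * (1 - N)) := by
  refine ⟨fun q₀ q₁ h₀ h₁ hsum hle => ?_,
    one_sub_half_sqrt_add_sqrt_sq (by linarith) hN0.le (by ring)⟩
  rw [one_sub_half_sqrt_add_sqrt_sq h₀ h₁ hsum]
  obtain rfl : q₀ = 1 - q₁ := by linarith
  have hmono : q₁ * (1 - q₁) ≤ N * (1 - N) := by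
    nlinarith [mul_nonneg (sub_nonneg.2 hle) (by linarith : 0 ≤ 1 - N - q₁)]
  exact sub_le_sub_left (Real.sqrt_le_sqrt hmono) _
end

section
/- Let N > 0 be a real number. For every real ν with −√N ≤ ν ≤ √N, one has (N − ν²)/(√(1+ν²) − ν)² ≤ N·(N+1), and equality holds at ν = N/√(1+2N). (This is the optimization of the squeeze parameter for the binary (M = 2) squeezed-state probe: the optimal squeezing gives overlap σ_SS = exp(−2N(N+1)).) -/
theorem stmt_13 (N : ℝ) (hN : 0 < N) :
    (∀ ν : ℝ, -Real.sqrt N ≤ ν → ν ≤ Real.sqrt N →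
      (N - ν ^ 2) / (Real.sqrt (1 + ν ^ 2) - ν) ^ 2 ≤ N * (N + 1)) ∧
    (N - (N / Real.sqrt (1 + 2 * N)) ^ 2) /
        (Real.sqrt (1 + (N / Real.sqrt (1 + 2 * N)) ^ 2) - N / Real.sqrt (1 + 2 * N)) ^ 2
      = N * (N + 1) := by
  constructor
  · intro ν _ _
    have hs : Real.sqrt (1 + ν ^ 2) ^ 2 = 1 + ν ^ 2 := Real.sq_sqrt (by positivity)
    have ht : 0 < Real.sqrt (1 + ν ^ 2) - ν :=
      sub_pos.mpr (Real.lt_sqrt_of_sq_lt (by linarith))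
    set t := Real.sqrt (1 + ν ^ 2) - ν with htdef
    have hν : 2 * t * ν = 1 - t ^ 2 := by
      rw [htdef]
      linear_combination hs
    rw [div_le_iff₀ (by positivity)]
    refine le_of_mul_le_mul_left ?_ (by positivity : 0 < 4 * t ^ 2)
    have hsq : 4 * t ^ 2 * ν ^ 2 = (1 - t ^ 2) ^ 2 := by
      rw [← hν]
      ring
    linarith [sq_nonneg ((2 * N + 1) * t ^ 2 - 1)]
  · have hr : 0 < Real.sqrt (1 + 2 * N) := Real.sqrt_pos.mpr (by positivity)
    have hr2 : Real.sqrt (1 + 2 * N) ^ 2 = 1 + 2 * N := Real.sq_sqrt (by positivity)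
    set r := Real.sqrt (1 + 2 * N)
    have hμ : Real.sqrt (1 + (N / r) ^ 2) = (1 + N) / r := by
      rw [Real.sqrt_eq_iff_mul_self_eq (by positivity) (by positivity)]
      field_simp
      linear_combination hr2
    have hsub : (1 + N) / r - N / r = 1 / r := by ring
    rw [hμ, hsub]
    field_simp
    linear_combination hr2
end
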